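/- Let D → A be an injective ring homomorphism of integral domains with quotient fields K of D and L of A (K embedded in L), K ≠ D. The following are equivalent: (1) A is a t-linked extension of D; (2) for every prime t-ideal q of A, either q ∩ D = 0 or (q ∩ D)_t ≠ D; (3) for every t-maximal ideal q of A, q ∩ D is contained in some t-maximal ideal of D; (4) A = ⋂_{p ∈ t-Max(D)} A_p, the intersection inside L over all t-maximal ideals p of D, where A_p is the localization of A at the image of D ∖ p. -/

import Mathlib

namespace IVP

open Polynomial

variable {F : Type} [Field F]

/-- Integer-valued polynomials on the set `E` with values in `D`:
`Int(E,D) = {f ∈ F[X] : f(E) ⊆ D}`. -/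
def IntOn (E D : Set F) : Set (Polynomial F) := {f | ∀ x ∈ E, f.eval x ∈ D}

/-- `Int(D) = {f ∈ F[X] : f(D) ⊆ D}`. -/
def IntR (D : Set F) : Set (Polynomial F) := IntOn D D

/-- Polynomials with all coefficients in `R`, i.e. `R[X]` as a subset of `F[X]`. -/
def polySet (R : Set F) : Set (Polynomial F) := {f | ∀ n, f.coeff n ∈ R}

/-- `I⁻¹ = (D :_K I) = {x : x·I ⊆ D}`. -/
def dinv (D I : Set F) : Set F := {x | ∀ y ∈ I, x * y ∈ D}

/-- `I_v = (I⁻¹)⁻¹`. -/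
def dv (D I : Set F) : Set F := dinv D (dinv D I)

/-- `I_t = ⋃ J_v`, the union over all nonzero finitely generated fractional ideals
`J ⊆ I`; such a `J` is the `D`-span of a finite set `T ⊆ I` containing a nonzero
element, and `J_v` depends only on `T`. -/
def dt (D I : Set F) : Set F :=
  {x | ∃ T : Finset F, ↑T ⊆ I ∧ (∃ y ∈ T, y ≠ 0) ∧ x ∈ dv D ↑T}

/-- The image in `F` of a set of elements of the subring `D`. -/
def iset (D : Subring F) (I : Set ↥D) : Set F := (↑) '' I

/-- `I` is a t-ideal: `I_t = I`. -/
def IsTIdeal (D I : Set F) : Prop := dt D I = I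

/-- `I` is a v-ideal: `I_v = I`. -/
def IsVIdeal (D I : Set F) : Prop := dv D I = I

/-- `p` is a t-maximal ideal of `D`: maximal among the t-ideals properly contained
in `D`. -/
def IsTMax (D : Subring F) (p : Ideal ↥D) : Prop :=
  p ≠ ⊤ ∧ IsTIdeal ↑D (iset D ↑p) ∧
    ∀ q : Ideal ↥D, q ≠ ⊤ → IsTIdeal ↑D (iset D ↑q) → p ≤ q → p = q

/-- `p` is a v-maximal ideal of `D`: maximal among the v-ideals properly contained
in `D`. -/
def IsVMax (D : Subring F) (p : Ideal ↥D) : Prop :=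
  p ≠ ⊤ ∧ IsVIdeal ↑D (iset D ↑p) ∧
    ∀ q : Ideal ↥D, q ≠ ⊤ → IsVIdeal ↑D (iset D ↑q) → p ≤ q → p = q

/-- The localization `S⁻¹D` of `D` at a multiplicative subset `S ⊆ D`, as a subset
of `F`. -/
def mlocSet (D : Subring F) (S : Set ↥D) : Set F :=
  {x | ∃ a : ↥D, ∃ s ∈ S, (s : F) * x = (a : F)}

/-- The localization `D_p` of `D` at the complement of `p`, as a subset of `F`. -/
def plocSet (D : Subring F) (p : Ideal ↥D) : Set F := mlocSet D {s | s ∉ p}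

/-- The localization `S⁻¹R` of a set `R` of polynomials at a multiplicative subset
`S ⊆ D`, as a subset of `F[X]`. -/
def mlocPoly (D : Subring F) (S : Set ↥D) (R : Set (Polynomial F)) : Set (Polynomial F) :=
  {f | ∃ g ∈ R, ∃ s ∈ S, C (s : F) * f = g}

/-- The localization `R_p` of a set `R` of polynomials at `D ∖ p`. -/
def plocPoly (D : Subring F) (p : Ideal ↥D) (R : Set (Polynomial F)) : Set (Polynomial F) :=
  mlocPoly D {s | s ∉ p} R

/-- The ideal `pD_p` of the localization `D_p`, as a subset of `F`. -/
def plocIdl (D : Subring F) (p : Ideal ↥D) : Set F :=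
  {x | ∃ y ∈ p, ∃ s : ↥D, s ∉ p ∧ (s : F) * x = ((y : ↥D) : F)}

/-- `p` is t-localizing: `pD_p` is a t-ideal of `D_p`. -/
def TLocalizing (D : Subring F) (p : Ideal ↥D) : Prop :=
  IsTIdeal (plocSet D p) (plocIdl D p)

/-- `F` is the quotient field of `D`. -/
def IsQuotField (D : Subring F) : Prop :=
  ∀ x : F, ∃ a b : ↥D, b ≠ 0 ∧ (b : F) * x = (a : F)

/-- The quotient field of `D`, as a subset of the ambient field. -/
def fracSet (D : Subring F) : Set F :=
  {x | ∃ a b : ↥D, b ≠ 0 ∧ (b : F) * x = (a : F)}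

/-- The conductor ideal `(aD :_D bD) = {d ∈ D : d·b ∈ aD}` of `D`. -/
def Conductor (D : Subring F) (a b : ↥D) : Set ↥D := {d | ∃ c : ↥D, d * b = a * c}

/-- Elementwise product of two subsets of `F`. -/
def setMul (A B : Set F) : Set F := {z | ∃ x ∈ A, ∃ y ∈ B, z = x * y}

/-- The ideal `I` of `D` is t-invertible: `(I⁻¹I)_t = D`. -/
def TInv (D : Subring F) (I : Ideal ↥D) : Prop :=
  dt ↑D (setMul (dinv ↑D (iset D ↑I)) (iset D ↑I)) = (↑D : Set F)

/-- The ideal `I` of `D` is v-invertible: `(I⁻¹I)_v = D`. -/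
def VInv (D : Subring F) (I : Ideal ↥D) : Prop :=
  dv ↑D (setMul (dinv ↑D (iset D ↑I)) (iset D ↑I)) = (↑D : Set F)

/-- `D` is a PVMD: every nonzero finitely generated ideal of `D` is t-invertible. -/
def IsPVMD (D : Subring F) : Prop :=
  ∀ I : Ideal ↥D, I ≠ ⊥ → I.FG → TInv D I

/-- `D` is an H domain: every v-invertible nonzero ideal of `D` is t-invertible. -/
def IsHDomain (D : Subring F) : Prop :=
  ∀ I : Ideal ↥D, I ≠ ⊥ → VInv D I → TInv D I

/-- `p ∈ sKr(K/D)`: `p` is a prime such that every finitely generated ideal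
`I ⊆ p` satisfies `I ⊆ J ⊆ p` for some conductor ideal `J` of `D`. -/
def SKrMem (D : Subring F) (p : Ideal ↥D) : Prop :=
  p.IsPrime ∧ ∀ I : Ideal ↥D, I.FG → I ≤ p →
    ∃ a b : ↥D, a ≠ 0 ∧ (↑I : Set ↥D) ⊆ Conductor D a b ∧ Conductor D a b ⊆ ↑p

/-- The localization `A_p` of `A ⊇ D` at the complement in `D` of a prime `p` of `D`,
as a subset of the ambient field. -/
def mixedLocSet (D A : Subring F) (p : Ideal ↥D) : Set F :=
  {x | ∃ a : ↥A, ∃ s : ↥D, s ∉ p ∧ (s : F) * x = (a : F)}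

/-- `pD_p` is a principal ideal of `D_p`. -/
def PLocPrincipal (D : Subring F) (p : Ideal ↥D) : Prop :=
  ∃ g : F, plocIdl D p = {x | ∃ d ∈ plocSet D p, x = d * g}

/-- The localization `A_p` of `A ⊇ D` at a prime `p` of `D`, as a subring of the
ambient field. -/
def mixedLoc (D A : Subring F) (hDA : D ≤ A) (p : Ideal ↥D) (hp : p.IsPrime) :
    Subring F where
  carrier := mixedLocSet D A p
  one_mem' := ⟨1, 1, fun h => hp.ne_top (Ideal.eq_top_of_isUnit_mem p h isUnit_one), by simp⟩
  zero_mem' := ⟨0, 1, fun h => hp.ne_top (Ideal.eq_top_of_isUnit_mem p h isUnit_one), by simp⟩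
  mul_mem' := by
    rintro x y ⟨a, s, hs, hx⟩ ⟨b, t, ht, hy⟩
    refine ⟨a * b, s * t, fun h => ((hp.mem_or_mem h).elim hs ht), ?_⟩
    push_cast
    rw [mul_mul_mul_comm, hx, hy]
  add_mem' := by
    rintro x y ⟨a, s, hs, hx⟩ ⟨b, t, ht, hy⟩
    refine ⟨⟨t, hDA t.2⟩ * a + ⟨s, hDA s.2⟩ * b, s * t,
      fun h => ((hp.mem_or_mem h).elim hs ht), ?_⟩
    push_cast
    rw [mul_add]
    rw [show ((s:F) * t) * x = (t:F) * ((s:F) * x) by ring, hx,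
      show ((s:F) * t) * y = (s:F) * ((t:F) * y) by ring, hy]
  neg_mem' := by
    rintro x ⟨a, s, hs, hx⟩
    exact ⟨-a, s, hs, by push_cast; rw [mul_neg, hx]⟩

/-- The localization `D_p` of `D` at a prime `p`, as a subring of `F`. -/
def primeLoc (D : Subring F) (p : Ideal ↥D) (hp : p.IsPrime) : Subring F :=
  mixedLoc D D le_rfl p hp

/-- `Int(D)` as a subring of `F[X]`. -/
def IntSubring (D : Subring F) : Subring (Polynomial F) where
  carrier := IntR ↑D
  one_mem' := fun x _ => by simpa using D.one_mem
  zero_mem' := fun x _ => by simpa using D.zero_mem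
  mul_mem' := fun hf hg x hx => by
    rw [eval_mul]; exact D.mul_mem (hf x hx) (hg x hx)
  add_mem' := fun hf hg x hx => by
    rw [eval_add]; exact D.add_mem (hf x hx) (hg x hx)
  neg_mem' := fun hf x hx => by
    rw [eval_neg]; exact D.neg_mem (hf x hx)

/-- `Int(D)` as a `D`-submodule of `F[X]`. -/
def intSubmodule (D : Subring F) : Submodule ↥D (Polynomial F) where
  carrier := IntR ↑D
  zero_mem' := fun x _ => by simpa using D.zero_mem
  add_mem' := fun hf hg x hx => by
    rw [eval_add]; exact D.add_mem (hf x hx) (hg x hx)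
  smul_mem' := fun c f hf x hx => by
    have h : c • f = C (c : F) * f := by
      rw [Algebra.smul_def]; rfl
    rw [h, eval_mul, eval_C]
    exact D.mul_mem c.2 (hf x hx)

/-- An overring `D'` of `D` as a `D`-submodule of `F`. -/
def subringSubmodule (D D' : Subring F) (h : D ≤ D') : Submodule ↥D F where
  carrier := ↑D'
  zero_mem' := D'.zero_mem
  add_mem' := fun ha hb => D'.add_mem ha hb
  smul_mem' := fun c x hx => by
    rw [Subring.smul_def]
    exact D'.mul_mem (h c.2) hx

/-- `Int(D)_p` as a `D_p`-submodule of `F[X]`. -/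
def plocIntSubmodule (D : Subring F) (p : Ideal ↥D) (hp : p.IsPrime) :
    Submodule ↥(primeLoc D p hp) (Polynomial F) where
  carrier := plocPoly D p (IntR ↑D)
  zero_mem' :=
    ⟨0, fun x _ => by simpa using D.zero_mem, 1,
      fun h => hp.ne_top (Ideal.eq_top_of_isUnit_mem p h isUnit_one), by simp⟩
  add_mem' := by
    rintro f f' ⟨g, hg, s, hs, hfg⟩ ⟨g', hg', t, ht, hfg'⟩
    refine ⟨C (t : F) * g + C (s : F) * g', ?_, s * t,
      fun h => ((hp.mem_or_mem h).elim hs ht), ?_⟩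
    · intro x hx
      rw [eval_add, eval_mul, eval_mul, eval_C, eval_C]
      exact D.add_mem (D.mul_mem t.2 (hg x hx)) (D.mul_mem s.2 (hg' x hx))
    · rw [← hfg, ← hfg']
      push_cast
      rw [map_mul]
      ring
  smul_mem' := by
    rintro c f ⟨g, hg, t, ht, hfg⟩
    obtain ⟨a, s, hs, hsc⟩ := c.2
    have h : c • f = C (c : F) * f := by rw [Algebra.smul_def]; rfl
    refine ⟨C (a : F) * g, ?_, s * t,
      fun hmem => ((hp.mem_or_mem hmem).elim hs ht), ?_⟩
    · intro x hx
      rw [eval_mul, eval_C]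
      exact D.mul_mem a.2 (hg x hx)
    · rw [h, ← hfg, ← hsc]
      push_cast
      rw [map_mul, map_mul]
      ring

section Extensions

variable {L : Type} [Field L]

/-- The data of an extension: the subring `A` of `L` contains the image of `D`
under the embedding `φ` of quotient fields. -/
def ExtMem (D : Subring F) (φ : F →+* L) (A : Subring L) : Prop := ∀ d : ↥D, φ d ∈ A

/-- The injective ring homomorphism `D → A` induced by `φ`. -/
noncomputable def extHom (D : Subring F) (φ : F →+* L) (A : Subring L)
    (h : ExtMem D φ A) : ↥D →+* ↥A :=
  (φ.comp D.subtype).codRestrict A.toSubsemiring (fun d => h d)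

/-- The extension `A ⊇ D` is polynomially regular: `Int(D,A) = A·Int(D)`. -/
def PolyReg (D : Subring F) (φ : F →+* L) (A : Subring L) : Prop :=
  IntOn (φ '' ↑D) ↑A = ↑(Submodule.span ↥A (Polynomial.map φ '' IntR (↑D : Set F)))

/-- The extension `A ⊇ D` is weakly polynomially complete: `Int(D) ⊆ Int(A)`. -/
def WPolyComplete (D : Subring F) (φ : F →+* L) (A : Subring L) : Prop :=
  Polynomial.map φ '' IntR (↑D : Set F) ⊆ IntR (↑A : Set L)

/-- The extension `A ⊇ D` is polynomially complete: `Int(D,A) = Int(A)`. -/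
def PolyComplete (D : Subring F) (φ : F →+* L) (A : Subring L) : Prop :=
  IntOn (φ '' ↑D) ↑A = IntR (↑A : Set L)

/-- The extension `A ⊇ D` is flat: `A` is flat as a `D`-module. -/
def ExtFlat (D : Subring F) (φ : F →+* L) (A : Subring L) (h : ExtMem D φ A) : Prop :=
  letI : Module ↥D ↥A := Module.compHom ↥A (extHom D φ A h)
  Module.Flat ↥D ↥A

/-- The extension `A ⊇ D` is t-linked: `I_t = D` implies `(IA)_t = A` for every
nonzero ideal `I` of `D`. -/
def TLinkedExt (D : Subring F) (φ : F →+* L) (A : Subring L) (h : ExtMem D φ A) : Prop :=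
  ∀ I : Ideal ↥D, I ≠ ⊥ → dt ↑D (iset D ↑I) = (↑D : Set F) →
    dt ↑A (iset A ↑(Ideal.map (extHom D φ A h) I)) = (↑A : Set L)

/-- `D` is absolutely polynomially regular: every extension of `D` is polynomially
regular. -/
def AbsPolyReg (D : Subring F) : Prop :=
  ∀ (L : Type) [Field L], ∀ (φ : F →+* L) (A : Subring L),
    ExtMem D φ A → IsQuotField A → PolyReg D φ A

/-- `D` is polynomially F-regular: every flat extension of `D` is polynomially
regular. -/
def PFReg (D : Subring F) : Prop :=
  ∀ (L : Type) [Field L], ∀ (φ : F →+* L) (A : Subring L) (h : ExtMem D φ A),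
    IsQuotField A → ExtFlat D φ A h → PolyReg D φ A

/-- `D` is polynomially t-regular: every t-linked extension of `D` is polynomially
regular. -/
def PTReg (D : Subring F) : Prop :=
  ∀ (L : Type) [Field L], ∀ (φ : F →+* L) (A : Subring L) (h : ExtMem D φ A),
    IsQuotField A → TLinkedExt D φ A h → PolyReg D φ A

/-- `D` is polynomially L-regular: `Int(S⁻¹D) = S⁻¹Int(D)` for every multiplicative
subset `S` of `D` with `0 ∉ S`. -/
def PLReg (D : Subring F) : Prop :=
  ∀ S : Submonoid ↥D, (0 : ↥D) ∉ S →
    IntR (mlocSet D ↑S) = mlocPoly D ↑S (IntR (↑D : Set F))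

end Extensions

/-- The extension of an ideal `I` of `R` to an overring `S` of `R` inside a common
field: the ideal `IS` of `S` generated by `I`. -/
def extIdeal (R S : Subring F) (I : Ideal ↥R) : Ideal ↥S :=
  Ideal.span {y : ↥S | (y : F) ∈ iset R ↑I}

/-- Within a common field: `S` is a t-linked extension of `R`. -/
def TLinkedSub (R S : Subring F) : Prop :=
  R ≤ S ∧ ∀ I : Ideal ↥R, I ≠ ⊥ → dt ↑R (iset R ↑I) = (↑R : Set F) →
    dt ↑S (iset S ↑(extIdeal R S I)) = (↑S : Set F)

/-- Localization of a subset `R` of the ambient field at `D ∖ q`. -/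
def locOfSet (D : Subring F) (R : Set F) (q : Ideal ↥D) : Set F :=
  {x | ∃ y ∈ R, ∃ s : ↥D, s ∉ q ∧ (s : F) * x = y}

end IVP

open IVP Polynomial

namespace IVP

section TOperation

variable {F : Type} [Field F]

theorem dinv_anti {D I J : Set F} (h : I ⊆ J) : dinv D J ⊆ dinv D I :=
  fun _ hx y hy => hx y (h hy)

theorem dt_mono {D I J : Set F} (h : I ⊆ J) : dt D I ⊆ dt D J :=
  fun _ ⟨T, hT, hne, hx⟩ => ⟨T, hT.trans h, hne, hx⟩

theorem coe_mem_iset {D : Subring F} {I : Ideal ↥D} {d : ↥D} :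
    (d : F) ∈ iset D ↑I ↔ d ∈ I :=
  ⟨fun ⟨_, he, h⟩ => Subtype.ext h ▸ he, fun h => ⟨d, h, rfl⟩⟩

theorem iset_mono {D : Subring F} {I J : Ideal ↥D} (h : I ≤ J) :
    iset D ↑I ⊆ iset D ↑J :=
  Set.image_mono h

theorem iset_subset (D : Subring F) (I : Ideal ↥D) : iset D ↑I ⊆ (↑D : Set F) := by
  rintro _ ⟨d, -, rfl⟩
  exact d.2

theorem dt_iset_subset (D : Subring F) (I : Ideal ↥D) :
    dt ↑D (iset D ↑I) ⊆ (↑D : Set F) := by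
  rintro x ⟨T, hT, -, hx⟩
  have h1 : (1 : F) ∈ dinv (↑D : Set F) ↑T := fun y hy => by
    simpa using iset_subset D I (hT hy)
  simpa using hx 1 h1

/-- `I_t = D` exactly when `I` contains a nonzero finite set `T` with `T⁻¹ ⊆ D`. -/
theorem dt_iset_eq_iff {D : Subring F} {I : Ideal ↥D} :
    dt ↑D (iset D ↑I) = (↑D : Set F) ↔
      ∃ T : Finset F, ↑T ⊆ iset D ↑I ∧ (∃ y ∈ T, y ≠ 0) ∧
        dinv (↑D : Set F) ↑T ⊆ (↑D : Set F) := by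
  constructor
  · intro h
    obtain ⟨T, hT, hne, h1⟩ : (1 : F) ∈ dt ↑D (iset D ↑I) := by
      rw [h]
      exact D.one_mem
    exact ⟨T, hT, hne, fun x hx => by simpa using h1 x hx⟩
  · rintro ⟨T, hT, hne, h⟩
    exact (dt_iset_subset D I).antisymm
      fun d hd => ⟨T, hT, hne, fun x hx => D.mul_mem hd (h hx)⟩

theorem dt_iset_eq_of_le {D : Subring F} {I J : Ideal ↥D} (hIJ : I ≤ J)
    (h : dt ↑D (iset D ↑I) = (↑D : Set F)) : dt ↑D (iset D ↑J) = (↑D : Set F) :=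
  (dt_iset_subset D J).antisymm (h.ge.trans (dt_mono (iset_mono hIJ)))

theorem dt_iset_top (D : Subring F) : dt ↑D (iset D ↑(⊤ : Ideal ↥D)) = (↑D : Set F) :=
  dt_iset_eq_iff.2 ⟨{1}, Finset.coe_singleton (1 : F) ▸ Set.singleton_subset_iff.2 ⟨1, trivial, rfl⟩,
    ⟨1, by simp, one_ne_zero⟩, fun x hx => by simpa using hx 1 (by simp)⟩

theorem subset_dt_iset {D : Subring F} {I : Ideal ↥D} (hI : I ≠ ⊥) :
    iset D ↑I ⊆ dt ↑D (iset D ↑I) := by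
  classical
  obtain ⟨a, ha, ha0⟩ := Submodule.exists_mem_ne_zero_of_ne_bot hI
  intro x hx
  refine ⟨{x, (a : F)}, ?_, ⟨a, by simp, by simpa using ha0⟩, fun z hz => ?_⟩
  · simp [Set.insert_subset_iff, hx, coe_mem_iset.2 ha]
  · rw [mul_comm]
    exact hz x (by simp)

/-- The t-closure `I_t` of a nonzero ideal `I` of `D`, as an ideal of `D`. -/
def tClosure (D : Subring F) (I : Ideal ↥D) (hI : I ≠ ⊥) : Ideal ↥D where
  carrier := {d | (d : F) ∈ dt (↑D : Set F) (iset D ↑I)}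
  zero_mem' := subset_dt_iset hI (coe_mem_iset.2 I.zero_mem)
  add_mem' := by
    classical
    rintro a b ⟨T, hT, ⟨y, hy, hy0⟩, ha⟩ ⟨U, hU, -, hb⟩
    refine ⟨T ∪ U, by simp [hT, hU], ⟨y, by simp [hy], hy0⟩, fun z hz => ?_⟩
    rw [Subring.coe_add, add_mul]
    exact D.add_mem (ha z (dinv_anti (by simp) hz)) (hb z (dinv_anti (by simp) hz))
  smul_mem' := by
    rintro c a ⟨T, hT, hne, ha⟩
    refine ⟨T, hT, hne, fun z hz => ?_⟩
    rw [smul_eq_mul, Subring.coe_mul, mul_assoc]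
    exact D.mul_mem c.2 (ha z hz)

theorem iset_tClosure {D : Subring F} {I : Ideal ↥D} (hI : I ≠ ⊥) :
    iset D ↑(tClosure D I hI) = dt ↑D (iset D ↑I) := by
  ext x
  constructor
  · rintro ⟨d, hd, rfl⟩
    exact hd
  · exact fun hx => ⟨⟨x, dt_iset_subset D I hx⟩, hx, rfl⟩

theorem le_tClosure {D : Subring F} {I : Ideal ↥D} (hI : I ≠ ⊥) : I ≤ tClosure D I hI :=
  fun _ hd => subset_dt_iset hI (coe_mem_iset.2 hd)

theorem dt_iset_eq_of_dt_tClosure {D : Subring F} {I : Ideal ↥D} (hI : I ≠ ⊥)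
    (h : dt ↑D (iset D ↑(tClosure D I hI)) = (↑D : Set F)) :
    dt ↑D (iset D ↑I) = (↑D : Set F) := by
  classical
  obtain ⟨T, hT, ⟨y, hy, hy0⟩, hTD⟩ := dt_iset_eq_iff.1 h
  rw [iset_tClosure] at hT
  choose! U hU hne hxU using hT
  obtain ⟨z, hz, hz0⟩ := hne hy
  refine dt_iset_eq_iff.2 ⟨T.biUnion U, ?_,
    ⟨z, Finset.mem_biUnion.2 ⟨y, hy, hz⟩, hz0⟩, fun x hx => hTD fun t ht => ?_⟩
  · intro w hw
    obtain ⟨t, ht, hwt⟩ := Finset.mem_biUnion.1 (Finset.mem_coe.1 hw)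
    exact hU ht hwt
  · rw [mul_comm]
    exact hxU ht x (dinv_anti (Finset.coe_subset.2 (Finset.subset_biUnion_of_mem U ht)) hx)

/-- A nonzero ideal `I` with `I_t ≠ D` is contained in a t-maximal ideal. -/
theorem exists_isTMax_ge {D : Subring F} {I : Ideal ↥D} (hI : I ≠ ⊥)
    (h : dt ↑D (iset D ↑I) ≠ (↑D : Set F)) : ∃ p, IsTMax D p ∧ I ≤ p := by
  obtain ⟨p, hIp, hp⟩ := zorn_le_nonempty₀
    {J : Ideal ↥D | dt ↑D (iset D ↑J) ≠ (↑D : Set F)} (fun c hc hchain J hJ => by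
      refine ⟨sSup c, fun hs => ?_, fun _ => le_sSup⟩
      obtain ⟨T, hT, hne, hTD⟩ := dt_iset_eq_iff.1 hs
      have hsub : (↑T : Set F) ⊆ ⋃ K ∈ c, iset D ↑K := by
        intro t ht
        obtain ⟨d, hd, rfl⟩ := hT ht
        obtain ⟨K, hK, hdK⟩ :=
          (Submodule.mem_sSup_of_directed ⟨J, hJ⟩ hchain.directedOn).1 hd
        exact Set.mem_biUnion hK (coe_mem_iset.2 hdK)
      obtain ⟨K, hK, hTK⟩ := DirectedOn.exists_mem_subset_of_finset_subset_biUnion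
        ⟨J, hJ⟩ (hchain.directedOn.mono' fun _ _ _ _ h => iset_mono h) hsub
      exact hc hK (dt_iset_eq_iff.2 ⟨T, hTK, hne, hTD⟩)) I h
  have hp0 : p ≠ ⊥ := ne_bot_of_le_ne_bot hI hIp
  have hcl : tClosure D p hp0 = p :=
    le_antisymm (hp.2 (fun h => hp.1 (dt_iset_eq_of_dt_tClosure hp0 h)) (le_tClosure hp0))
      (le_tClosure hp0)
  refine ⟨p, ⟨fun htop => hp.1 (htop ▸ dt_iset_top D), ?_, fun q hq hqt hpq => ?_⟩, hIp⟩
  · rw [IsTIdeal, ← iset_tClosure hp0, hcl]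
  · refine le_antisymm hpq (hp.2 (fun h => hq ?_) hpq)
    rw [IsTIdeal, h] at hqt
    rw [Ideal.eq_top_iff_one, ← coe_mem_iset, ← hqt]
    exact D.one_mem

theorem dt_iset_ne_of_isTIdeal {D : Subring F} {p : Ideal ↥D} (hp : p ≠ ⊤)
    (ht : IsTIdeal ↑D (iset D ↑p)) : dt ↑D (iset D ↑p) ≠ (↑D : Set F) := by
  intro h
  rw [IsTIdeal, h] at ht
  apply hp
  rw [Ideal.eq_top_iff_one, ← coe_mem_iset, ← ht]
  exact D.one_mem

theorem IsTMax.dt_ne_of_le {D : Subring F} {p I : Ideal ↥D} (hp : IsTMax D p) (h : I ≤ p) :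
    dt ↑D (iset D ↑I) ≠ (↑D : Set F) :=
  fun hI => dt_iset_ne_of_isTIdeal hp.1 hp.2.1 (dt_iset_eq_of_le h hI)

theorem IsTMax.dt_eq_of_lt {D : Subring F} {p J : Ideal ↥D} (hp : IsTMax D p) (h : p < J) :
    dt ↑D (iset D ↑J) = (↑D : Set F) := by
  by_contra hJ
  obtain ⟨q, hq, hJq⟩ := exists_isTMax_ge (bot_le.trans_lt h).ne' hJ
  exact (h.trans_le hJq).ne (hp.2.2 q hq.1 hq.2.1 (h.le.trans hJq))

theorem dt_iset_mul_eq {D : Subring F} {I J : Ideal ↥D}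
    (hI : dt ↑D (iset D ↑I) = (↑D : Set F)) (hJ : dt ↑D (iset D ↑J) = (↑D : Set F)) :
    dt ↑D (iset D ↑(I * J)) = (↑D : Set F) := by
  classical
  obtain ⟨T, hT, ⟨y, hy, hy0⟩, hTD⟩ := dt_iset_eq_iff.1 hI
  obtain ⟨U, hU, ⟨z, hz, hz0⟩, hUD⟩ := dt_iset_eq_iff.1 hJ
  refine dt_iset_eq_iff.2 ⟨Finset.image₂ (· * ·) T U, fun w hw => ?_,
    ⟨y * z, Finset.mem_image₂_of_mem hy hz, mul_ne_zero hy0 hz0⟩,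
    fun x hx => hTD fun t ht => hUD fun u hu => ?_⟩
  · obtain ⟨t, ht, u, hu, rfl⟩ := Finset.mem_image₂.1 (Finset.mem_coe.1 hw)
    obtain ⟨a, ha, rfl⟩ := hT ht
    obtain ⟨b, hb, rfl⟩ := hU hu
    exact ⟨a * b, Ideal.mul_mem_mul ha hb, rfl⟩
  · rw [mul_assoc]
    exact hx _ (Finset.mem_coe.2 (Finset.mem_image₂_of_mem ht hu))

theorem IsTMax.isPrime {D : Subring F} {p : Ideal ↥D} (hp : IsTMax D p) : p.IsPrime := by
  refine ⟨hp.1, fun {a b} hab => ?_⟩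
  by_contra! hne
  have hlt : ∀ c : ↥D, c ∉ p → p < p ⊔ Ideal.span {c} := fun c hc =>
    left_lt_sup.2 fun h => hc (h (Ideal.mem_span_singleton_self c))
  refine hp.dt_ne_of_le ?_
    (dt_iset_mul_eq (hp.dt_eq_of_lt (hlt a hne.1)) (hp.dt_eq_of_lt (hlt b hne.2)))
  rw [Ideal.sup_mul]
  refine sup_le Ideal.mul_le_left ?_
  rw [Ideal.mul_sup, Ideal.span_singleton_mul_span_singleton]
  exact sup_le Ideal.mul_le_right ((Ideal.span_singleton_le_iff_mem p).2 hab)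

theorem exists_isTMax {D : Subring F} (hD : fracSet D ≠ (↑D : Set F)) :
    ∃ p, IsTMax D p := by
  obtain ⟨a, ha0, ha⟩ : ∃ a : ↥D, a ≠ 0 ∧ ((a : F)⁻¹) ∉ D := by
    by_contra! h
    refine hD (Set.Subset.antisymm ?_ fun x hx => ⟨⟨x, hx⟩, 1, one_ne_zero, by simp⟩)
    rintro x ⟨a, b, hb, hx⟩
    have hb' : (b : F) ≠ 0 := by simpa using hb
    rw [show x = (b : F)⁻¹ * a by rw [← hx, inv_mul_cancel_left₀ hb']]
    exact D.mul_mem (h b hb) a.2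
  have ha0' : (a : F) ≠ 0 := by simpa using ha0
  refine (exists_isTMax_ge (I := Ideal.span {a}) (by simpa using ha0) fun h => ?_).imp
    fun _ hp => hp.1
  obtain ⟨T, hT, -, hTD⟩ := dt_iset_eq_iff.1 h
  refine ha (hTD fun t ht => ?_)
  obtain ⟨d, hd, rfl⟩ := hT ht
  obtain ⟨c, rfl⟩ := Ideal.mem_span_singleton'.1 hd
  rw [Subring.coe_mul, mul_left_comm, inv_mul_cancel₀ ha0', mul_one]
  exact c.2

/-- The ideal `{d ∈ D : d·x ∈ A}` of `D`. -/
def denominatorIdeal (D A : Subring F) (hDA : D ≤ A) (x : F) : Ideal ↥D where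
  carrier := {d | (d : F) * x ∈ A}
  zero_mem' := by simp
  add_mem' := fun ha hb => by
    simpa only [Set.mem_ofPred_eq, Subring.coe_add, add_mul] using A.add_mem ha hb
  smul_mem' := fun c a ha => by
    simpa only [Set.mem_ofPred_eq, smul_eq_mul, Subring.coe_mul, mul_assoc]
      using A.mul_mem (hDA c.2) ha

theorem extIdeal_le_iff {D A : Subring F} (hDA : D ≤ A) {I : Ideal ↥D} {J : Ideal ↥A} :
    extIdeal D A I ≤ J ↔ I ≤ J.comap (Subring.inclusion hDA) := by
  refine Ideal.span_le.trans ⟨fun h d hd => h (coe_mem_iset.2 hd), fun h => ?_⟩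
  rintro y ⟨d, hd, hy⟩
  rw [show y = Subring.inclusion hDA d from Subtype.ext hy.symm]
  exact h hd

theorem iset_subset_iset_extIdeal {D A : Subring F} (hDA : D ≤ A) (I : Ideal ↥D) :
    iset D ↑I ⊆ iset A ↑(extIdeal D A I) := by
  rintro _ ⟨d, hd, rfl⟩
  exact ⟨Subring.inclusion hDA d, (extIdeal_le_iff hDA).1 le_rfl hd, rfl⟩

theorem TLinkedSub.dt_comap_ne {D A : Subring F} (hDA : D ≤ A) (h : TLinkedSub D A)
    {q : Ideal ↥A} (hq : q.IsPrime) (hqt : IsTIdeal ↑A (iset A ↑q)) :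
    q.comap (Subring.inclusion hDA) = ⊥ ∨
      dt ↑D (iset D ↑(q.comap (Subring.inclusion hDA))) ≠ (↑D : Set F) :=
  or_iff_not_imp_left.2 fun h0 ht => dt_iset_ne_of_isTIdeal hq.ne_top hqt
    (dt_iset_eq_of_le ((extIdeal_le_iff hDA).2 le_rfl) (h.2 _ h0 ht))

theorem exists_isTMax_comap_le {D A : Subring F} (hDA : D ≤ A)
    (hD : fracSet D ≠ (↑D : Set F)) {q : Ideal ↥A}
    (h : q.comap (Subring.inclusion hDA) = ⊥ ∨
      dt ↑D (iset D ↑(q.comap (Subring.inclusion hDA))) ≠ (↑D : Set F)) :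
    ∃ p : Ideal ↥D, IsTMax D p ∧ q.comap (Subring.inclusion hDA) ≤ p := by
  by_cases h0 : q.comap (Subring.inclusion hDA) = ⊥
  · exact (exists_isTMax hD).imp fun p hp => ⟨hp, h0 ▸ bot_le⟩
  · exact exists_isTMax_ge h0 (h.resolve_left h0)

theorem tLinkedSub_of_comap_le {D A : Subring F} (hDA : D ≤ A)
    (h : ∀ q : Ideal ↥A, IsTMax A q →
      ∃ p : Ideal ↥D, IsTMax D p ∧ q.comap (Subring.inclusion hDA) ≤ p) :
    TLinkedSub D A := by
  refine ⟨hDA, fun I hI hIt => ?_⟩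
  by_contra hA
  have h0 : extIdeal D A I ≠ ⊥ := fun h0 => hI <| by
    have := (extIdeal_le_iff hDA).1 h0.le
    rwa [← RingHom.ker_eq_comap_bot,
      (RingHom.injective_iff_ker_eq_bot _).1 (Subring.inclusion_injective hDA), le_bot_iff] at this
  obtain ⟨q, hq, hIq⟩ := exists_isTMax_ge h0 hA
  obtain ⟨p, hp, hqp⟩ := h q hq
  exact hp.dt_ne_of_le (((extIdeal_le_iff hDA).1 hIq).trans hqp) hIt

theorem subset_mixedLocSet {D : Subring F} (A : Subring F) {p : Ideal ↥D} (hp : p ≠ ⊤) :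
    (↑A : Set F) ⊆ mixedLocSet D A p :=
  fun x hx => ⟨⟨x, hx⟩, 1, (Ideal.ne_top_iff_one p).1 hp, by simp⟩

theorem TLinkedSub.eq_iInter {D A : Subring F} (h : TLinkedSub D A)
    (hD : fracSet D ≠ (↑D : Set F)) :
    (↑A : Set F) = ⋂ p ∈ {p : Ideal ↥D | IsTMax D p}, mixedLocSet D A p := by
  refine Set.Subset.antisymm
    (Set.subset_iInter₂ fun p hp => subset_mixedLocSet A hp.1) fun x hx => ?_
  have hx : ∀ p, IsTMax D p → ¬ denominatorIdeal D A h.1 x ≤ p := by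
    intro p hp hle
    obtain ⟨a, s, hs, hsa⟩ := Set.mem_iInter₂.1 hx p hp
    exact hs (hle (show (s : F) * x ∈ A from hsa ▸ a.2))
  have h0 : denominatorIdeal D A h.1 x ≠ ⊥ := fun h0 =>
    let ⟨p, hp⟩ := exists_isTMax hD
    hx p hp (h0.le.trans bot_le)
  have ht : dt ↑D (iset D ↑(denominatorIdeal D A h.1 x)) = (↑D : Set F) := by
    by_contra ht
    obtain ⟨p, hp, hle⟩ := exists_isTMax_ge h0 ht
    exact hx p hp hle
  have hA := dt_iset_eq_of_le (J := denominatorIdeal A A le_rfl x)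
    ((extIdeal_le_iff h.1).2 fun d hd => hd) (h.2 _ h0 ht)
  obtain ⟨T, hT, -, hTA⟩ := dt_iset_eq_iff.1 hA
  refine hTA fun t ht => ?_
  obtain ⟨a, ha, rfl⟩ := hT ht
  rw [mul_comm]
  exact ha

theorem tLinkedSub_of_eq_iInter {D A : Subring F} (hDA : D ≤ A)
    (h : (↑A : Set F) = ⋂ p ∈ {p : Ideal ↥D | IsTMax D p}, mixedLocSet D A p) :
    TLinkedSub D A := by
  refine ⟨hDA, fun I _ hIt => ?_⟩
  obtain ⟨T, hT, hne, hTD⟩ := dt_iset_eq_iff.1 hIt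
  refine dt_iset_eq_iff.2
    ⟨T, hT.trans (iset_subset_iset_extIdeal hDA I), hne, fun x hx => ?_⟩
  rw [h]
  refine Set.mem_iInter₂.2 fun p hp => ?_
  obtain ⟨t, ht, htp⟩ : ∃ t ∈ T, t ∉ iset D ↑p := by
    by_contra! hTp
    exact dt_iset_ne_of_isTIdeal hp.1 hp.2.1 (dt_iset_eq_iff.2 ⟨T, hTp, hne, hTD⟩)
  obtain ⟨s, -, rfl⟩ := hT ht
  exact ⟨⟨x * s, hx _ ht⟩, s, fun hs => htp (coe_mem_iset.2 hs), mul_comm _ _⟩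

end TOperation

end IVP

/-- Characterizations of t-linked extensions: `A ⊇ D` is t-linked iff
(2) every t-prime of `A` contracts to `0` or to an ideal with `(q ∩ D)_t ≠ D`, iff
(3) every t-maximal ideal of `A` contracts into a t-maximal ideal of `D`, iff
(4) `A = ⋂_{p ∈ t-Max(D)} A_p`. -/
theorem stmt_7 (L : Type) [Field L] (D A : Subring L) (hDA : D ≤ A)
    (hqfA : IsQuotField A) (hKD : fracSet D ≠ (↑D : Set L)) :
    (TLinkedSub D A ↔
        ∀ q : Ideal ↥A, q.IsPrime → IsTIdeal ↑A (iset A ↑q) →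
          q.comap (Subring.inclusion hDA) = ⊥ ∨
            dt ↑D (iset D ↑(q.comap (Subring.inclusion hDA))) ≠ (↑D : Set L)) ∧
      (TLinkedSub D A ↔
        ∀ q : Ideal ↥A, IsTMax A q →
          ∃ p : Ideal ↥D, IsTMax D p ∧ q.comap (Subring.inclusion hDA) ≤ p) ∧
      (TLinkedSub D A ↔
        (↑A : Set L) = ⋂ p ∈ {p : Ideal ↥D | IsTMax D p}, mixedLocSet D A p) := by
  have h12 : TLinkedSub D A → _ := fun h q hq => h.dt_comap_ne hDA (q := q) hq
  have h23 := fun q : Ideal ↥A => exists_isTMax_comap_le hDA hKD (q := q)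
  have h31 := tLinkedSub_of_comap_le hDA
  exact ⟨⟨h12, fun h => h31 fun q hq => h23 q (h q hq.isPrime hq.2.1)⟩,
    ⟨fun h q hq => h23 q (h12 h q hq.isPrime hq.2.1), h31⟩,
    fun h => h.eq_iInter hKD, tLinkedSub_of_eq_iInter hDA⟩
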